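/- Let f: M^k → M^l be a definable function such that f⁻¹(p) is finite for every p ∈ M^l. Then almost every p ∈ M^k has a neighborhood V such that the restriction of f to V is injective. -/

import Mathlib

/-! Common framework: dp-minimal structures with a definable uniform structure,
following "Dp-minimal structures equipped with definable uniformities". -/

namespace DpTame

open FirstOrder Set Cardinal

universe u

variable (L : FirstOrder.Language.{u, u}) (M : Type u) [L.Structure M]

/-- `A ⊆ M^α` is definable with parameters from `C ⊆ M`. -/
def DefSetP (C : Set M) {α : Type} (A : Set (α → M)) : Prop :=
  C.Definable L A

/-- `A ⊆ M^α` is definable (with parameters from `M`). -/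
def DefSet {α : Type} (A : Set (α → M)) : Prop :=
  (Set.univ : Set M).Definable L A

/-- A subset of `M` is definable (with parameters). -/
def DefSet1 (A : Set M) : Prop :=
  DefSet L M {v : Fin 1 → M | v 0 ∈ A}

/-- A definable relation between two tuple sorts, with parameters from `C`. -/
def DefRelP (C : Set M) {k l : ℕ} (G : Set ((Fin k → M) × (Fin l → M))) : Prop :=
  DefSetP L M C {v : (Fin k ⊕ Fin l) → M | (v ∘ Sum.inl, v ∘ Sum.inr) ∈ G}

/-- A definable relation between two tuple sorts, with parameters from `M`. -/
def DefRel {k l : ℕ} (G : Set ((Fin k → M) × (Fin l → M))) : Prop :=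
  DefRelP L M Set.univ G

/-- A definable subset of `M × M`. -/
def DefRel1 (G : Set (M × M)) : Prop :=
  DefSet L M {v : Fin 2 → M | (v 0, v 1) ∈ G}

/-- Model-theoretic algebraic closure of a parameter set `C ⊆ M`:
`a` lies in a finite `C`-definable set. -/
def aclOf (C : Set M) : Set M :=
  {a | ∃ S : Set (Fin 1 → M), C.Definable L S ∧ S.Finite ∧ (fun _ => a) ∈ S}

/-- The acl-dimension of a tuple over `C`: the minimal size of a subtuple over which (together
with `C`) the whole tuple is algebraic. -/
noncomputable def aclDimTuple (C : Set M) {k : ℕ} (a : Fin k → M) : ℕ :=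
  sInf {l | ∃ s : Finset (Fin k), s.card = l ∧ ∀ i, a i ∈ aclOf L M (C ∪ (a '' ↑s))}

open Classical in
/-- The acl-dimension of a set `A ⊆ M^k` defined over `C` (with `⊥` for the empty set). -/
noncomputable def aclDim (C : Set M) {k : ℕ} (A : Set (Fin k → M)) : WithBot ℕ :=
  if A = ∅ then ⊥ else ↑(sSup {l | ∃ a ∈ A, aclDimTuple L M C a = l})

/-- `A ⊆ M^k` has dp-rank greater than `n`: there are (definable-with-parameters) formulas
`φ_i(x,y)` for `i ≤ n` (coded as definable subsets of `M^k × M`) and infinite sets `B i ⊆ M`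
such that every choice from `∏ B i` is coded by an element of `A`. -/
def DpRankGt {k : ℕ} (A : Set (Fin k → M)) (n : ℕ) : Prop :=
  ∃ (Φ : Fin (n + 1) → Set ((Fin k ⊕ Fin 1) → M)) (B : Fin (n + 1) → Set M),
    (∀ i, DefSet L M (Φ i)) ∧ (∀ i, (B i).Infinite) ∧
    ∀ b : Fin (n + 1) → M, (∀ i, b i ∈ B i) →
      ∃ a ∈ A, ∀ i, ∀ y ∈ B i, (Sum.elim a (fun _ => y) ∈ Φ i ↔ y = b i)

open Classical in
/-- The dp-rank of a definable set, with `⊥` for the empty set. -/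
noncomputable def dpRank {k : ℕ} (A : Set (Fin k → M)) : WithBot ℕ :=
  if A = ∅ then ⊥ else ↑(sSup {m : ℕ | ∃ n, m = n + 1 ∧ DpRankGt L M A n})

/-- Dp-minimality (with respect to the home sort `M`): `M` does not have dp-rank greater
than one. -/
def DpMinimal : Prop :=
  ¬ DpRankGt L M (Set.univ : Set (Fin 1 → M)) 1

/-- `M` is NIP: no definable relation has the independence property. -/
def IsNIP : Prop :=
  ∀ (n m : ℕ) (Φ : Set ((Fin n ⊕ Fin m) → M)), DefSet L M Φ →
    ¬ ∃ (a : ℕ → Fin n → M) (b : Finset ℕ → Fin m → M),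
        ∀ (i : ℕ) (s : Finset ℕ), (Sum.elim (a i) (b s) ∈ Φ ↔ i ∈ s)

/-- Every finitely satisfiable collection of formulas in one variable over `C` is realized. -/
def RealizesTypesOver (C : Set M) : Prop :=
  ∀ p : Set ((L[[C]]).Formula (Fin 1)),
    (∀ s : Finset ((L[[C]]).Formula (Fin 1)), ↑s ⊆ p →
      ∃ a : M, ∀ φ ∈ s, φ.Realize (fun _ => a)) →
    ∃ a : M, ∀ φ ∈ p, φ.Realize (fun _ => a)

/-- `M` is `|L|⁺`-saturated. -/
def IsLPlusSaturated : Prop :=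
  ∀ C : Set M, #C ≤ L.card + ℵ₀ → RealizesTypesOver L M C

/-- Two tuples have the same type over `C`. -/
def SameTypeOver (C : Set M) {n : ℕ} (a b : Fin n → M) : Prop :=
  ∀ φ : (L[[C]]).Formula (Fin n), φ.Realize a ↔ φ.Realize b

/-- A sequence indexed by `ℕ` is indiscernible over `C`. -/
def IndiscernibleOver (C : Set M) (I : ℕ → M) : Prop :=
  ∀ (n : ℕ) (f g : Fin n → ℕ), StrictMono f → StrictMono g →
    SameTypeOver L M C (I ∘ f) (I ∘ g)

/-- The sequences `I l` are mutually indiscernible over `C`: each is indiscernible over `C`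
together with all of the other sequences. -/
def MutuallyIndiscernibleOver (C : Set M) {k : ℕ} (I : Fin k → ℕ → M) : Prop :=
  ∀ l : Fin k,
    IndiscernibleOver L M (C ∪ ⋃ m ∈ ({m : Fin k | m ≠ l} : Set (Fin k)), Set.range (I m)) (I l)

/-- A correspondence with domain `E ⊆ M^k`, values in `M^l`, definable over `C`: a definable
graph all of whose fibers over points of `E` are finite and nonempty. -/
def IsCorrP (C : Set M) {k l : ℕ} (E : Set (Fin k → M))
    (G : Set ((Fin k → M) × (Fin l → M))) : Prop :=
  DefRelP L M C G ∧ (∀ p ∈ G, p.1 ∈ E) ∧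
    ∀ x ∈ E, {y | (x, y) ∈ G}.Nonempty ∧ {y | (x, y) ∈ G}.Finite

/-- A correspondence, definable with arbitrary parameters. -/
def IsCorr {k l : ℕ} (E : Set (Fin k → M)) (G : Set ((Fin k → M) × (Fin l → M))) : Prop :=
  IsCorrP L M Set.univ E G

/-- An `m`-correspondence: every fiber has exactly `m` elements. -/
def IsMCorrP (C : Set M) {k l : ℕ} (E : Set (Fin k → M))
    (G : Set ((Fin k → M) × (Fin l → M))) (m : ℕ) : Prop :=
  IsCorrP L M C E G ∧ ∀ x ∈ E, {y | (x, y) ∈ G}.ncard = m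

/-- An `m`-correspondence definable with arbitrary parameters. -/
def IsMCorr {k l : ℕ} (E : Set (Fin k → M)) (G : Set ((Fin k → M) × (Fin l → M)))
    (m : ℕ) : Prop :=
  IsMCorrP L M Set.univ E G m

/-- A definable uniform structure on `M`: a definable basis of entourages
`{φ(M², c̄) : c̄ ∈ dom}` satisfying the axioms for a basis of a (Hausdorff) uniformity. -/
structure DefUniformBasis where
  n : ℕ
  dom : Set (Fin n → M)
  dom_nonempty : dom.Nonempty
  dom_def : DefSet L M dom
  phi : Set ((Fin 2 ⊕ Fin n) → M)
  phi_def : DefSet L M phi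
  symm : ∀ c ∈ dom, ∀ x y : M, Sum.elim ![x, y] c ∈ phi → Sum.elim ![y, x] c ∈ phi
  inter_eq_diag : ∀ x y : M, (∀ c ∈ dom, Sum.elim ![x, y] c ∈ phi) ↔ x = y
  directed : ∀ c ∈ dom, ∀ d ∈ dom, ∃ e ∈ dom, ∀ x y : M,
    Sum.elim ![x, y] e ∈ phi → Sum.elim ![x, y] c ∈ phi ∧ Sum.elim ![x, y] d ∈ phi
  comp : ∀ c ∈ dom, ∃ d ∈ dom, ∀ x y z : M,
    Sum.elim ![x, y] d ∈ phi → Sum.elim ![y, z] d ∈ phi → Sum.elim ![x, z] c ∈ phi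

namespace DefUniformBasis

variable {L M} (U : DefUniformBasis L M)

/-- The entourage with parameter `c`. -/
def ent (c : Fin U.n → M) : Set (M × M) :=
  {p | Sum.elim ![p.1, p.2] c ∈ U.phi}

/-- The ball of radius `c` around `x ∈ M`. -/
def ball (c : Fin U.n → M) (x : M) : Set M :=
  {y | (x, y) ∈ U.ent c}

/-- The ball of radius `c` around `x ∈ M^k` (product uniformity). -/
def ballk {k : ℕ} (c : Fin U.n → M) (x : Fin k → M) : Set (Fin k → M) :=
  {y | ∀ i, (x i, y i) ∈ U.ent c}

/-- Openness in `M` for the topology induced by the uniform structure. -/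
def IsOpen1 (A : Set M) : Prop :=
  ∀ x ∈ A, ∃ c ∈ U.dom, U.ball c x ⊆ A

/-- Interior in `M`. -/
def interior1 (A : Set M) : Set M :=
  {x | ∃ c ∈ U.dom, U.ball c x ⊆ A}

/-- Closure in `M`. -/
def closure1 (A : Set M) : Set M :=
  {x | ∀ c ∈ U.dom, (U.ball c x ∩ A).Nonempty}

/-- Openness in `M^k` for the product topology. -/
def IsOpenk {k : ℕ} (A : Set (Fin k → M)) : Prop :=
  ∀ x ∈ A, ∃ c ∈ U.dom, U.ballk c x ⊆ A

/-- Interior in `M^k`. -/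
def interiork {k : ℕ} (A : Set (Fin k → M)) : Set (Fin k → M) :=
  {x | ∃ c ∈ U.dom, U.ballk c x ⊆ A}

/-- Closure in `M^k`. -/
def closurek {k : ℕ} (A : Set (Fin k → M)) : Set (Fin k → M) :=
  {x | ∀ c ∈ U.dom, (U.ballk c x ∩ A).Nonempty}

/-- The frontier `∂A = cl(A) ∖ A`. -/
def frontierk {k : ℕ} (A : Set (Fin k → M)) : Set (Fin k → M) :=
  U.closurek A \ A

/-- Closedness in `M^k`. -/
def IsClosedk {k : ℕ} (A : Set (Fin k → M)) : Prop :=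
  U.closurek A ⊆ A

/-- `B` is dense in `A`. -/
def DenseIn {k : ℕ} (B A : Set (Fin k → M)) : Prop :=
  A ⊆ U.closurek B

/-- `A ⊆ M^k` is locally closed: every point of `A` has a (ball) neighborhood `W` such that
`A ∩ W` is closed in `W`. -/
def IsLocallyClosedk {k : ℕ} (A : Set (Fin k → M)) : Prop :=
  ∀ x ∈ A, ∃ c ∈ U.dom, U.ballk c x ∩ U.closurek (A ∩ U.ballk c x) ⊆ A

open Classical in
/-- The naive topological dimension of `A ⊆ M^k`: the largest `l` such that some coordinate
projection of `A` to `M^l` has nonempty interior (`⊥` for the empty set). -/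
noncomputable def topDim {k : ℕ} (A : Set (Fin k → M)) : WithBot ℕ :=
  if A = ∅ then ⊥ else
    ↑(sSup {l : ℕ | ∃ σ : Fin l → Fin k, Function.Injective σ ∧
        (U.interiork ((fun v => v ∘ σ) '' A)).Nonempty})

/-- Continuity of a correspondence with domain `E` and graph `G` at a point `x ∈ E`. -/
def CorrContAt {k l : ℕ} (E : Set (Fin k → M)) (G : Set ((Fin k → M) × (Fin l → M)))
    (x : Fin k → M) : Prop :=
  ∀ c ∈ U.dom, ∃ d ∈ U.dom, ∀ x' ∈ E, x' ∈ U.ballk d x →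
    (∀ y, (x, y) ∈ G → ∃ y', (x', y') ∈ G ∧ ∀ j, (y j, y' j) ∈ U.ent c) ∧
    (∀ y', (x', y') ∈ G → ∃ y, (x, y) ∈ G ∧ ∀ j, (y j, y' j) ∈ U.ent c)

/-- Continuity of a correspondence at every point of its domain. -/
def CorrContOn {k l : ℕ} (E : Set (Fin k → M)) (G : Set ((Fin k → M) × (Fin l → M))) : Prop :=
  ∀ x ∈ E, U.CorrContAt E G x

/-- Continuity of a function `M^k → M^l` on a set `V` (relative topology). -/
def ContOn {k l : ℕ} (f : (Fin k → M) → (Fin l → M)) (V : Set (Fin k → M)) : Prop :=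
  ∀ x ∈ V, ∀ c ∈ U.dom, ∃ d ∈ U.dom, ∀ y ∈ V, y ∈ U.ballk d x → f y ∈ U.ballk c (f x)

/-- `f` restricted to `V` is a homeomorphism onto its image. -/
def HomeoOnto {k l : ℕ} (f : (Fin k → M) → (Fin l → M)) (V : Set (Fin k → M)) : Prop :=
  Set.InjOn f V ∧ U.ContOn f V ∧
    ∀ x ∈ V, ∀ c ∈ U.dom, ∃ d ∈ U.dom, ∀ y ∈ V, f y ∈ U.ballk d (f x) → y ∈ U.ballk c x

/-- Continuity of a function `M → M` on a set `V`. -/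
def Cont1On (f : M → M) (V : Set M) : Prop :=
  ∀ x ∈ V, ∀ c ∈ U.dom, ∃ d ∈ U.dom, ∀ y ∈ V, y ∈ U.ball d x → f y ∈ U.ball c (f x)

/-- `f : M → M` restricted to `V` is a homeomorphism onto its image. -/
def Homeo1Onto (f : M → M) (V : Set M) : Prop :=
  Set.InjOn f V ∧ U.Cont1On f V ∧
    ∀ x ∈ V, ∀ c ∈ U.dom, ∃ d ∈ U.dom, ∀ y ∈ V, f y ∈ U.ball d (f x) → y ∈ U.ball c x

end DefUniformBasis

/-- The standing assumptions of the paper: `M` is an infinite `|L|⁺`-saturated NIP dp-minimal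
structure carrying a definable uniform structure whose topology has no isolated points and in
which every infinite definable subset of `M` has nonempty interior (Inf). -/
structure Setting extends DefUniformBasis L M where
  nonempty : Nonempty M
  saturated : IsLPlusSaturated L M
  nip : IsNIP L M
  dpMin : DpMinimal L M
  noIsolated : ∀ x : M, ∀ c ∈ toDefUniformBasis.dom, ∃ y, y ≠ x ∧
    y ∈ toDefUniformBasis.ball c x
  infInterior : ∀ A : Set M, DefSet1 L M A → A.Infinite →
    (toDefUniformBasis.interior1 A).Nonempty

end DpTame

namespace DpTame

open FirstOrder Set Cardinal

universe u

variable {L : FirstOrder.Language.{u, u}} {M : Type u} [L.Structure M]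

section Definability

variable {α β : Type}

theorem DefSet.and {P Q : (α → M) → Prop} (hP : DefSet L M {v | P v})
    (hQ : DefSet L M {v | Q v}) : DefSet L M {v | P v ∧ Q v} :=
  Definable.inter hP hQ

theorem DefSet.not {P : (α → M) → Prop} (hP : DefSet L M {v | P v}) :
    DefSet L M {v | ¬ P v} :=
  Definable.compl hP

theorem DefSet.imp {P Q : (α → M) → Prop} (hP : DefSet L M {v | P v})
    (hQ : DefSet L M {v | Q v}) : DefSet L M {v | P v → Q v} := by
  have h : {v | P v → Q v} = {v | ¬ (P v ∧ ¬ Q v)} := by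
    ext v; simp
  rw [h]
  exact (hP.and hQ.not).not

theorem DefSet.ex [Finite β] {P : (α → M) → (β → M) → Prop}
    (hP : DefSet L M {w : α ⊕ β → M | P (w ∘ Sum.inl) (w ∘ Sum.inr)}) :
    DefSet L M {v | ∃ b, P v b} :=
  Definable.exists_of_finite hP

theorem DefSet.all [Finite β] {P : (α → M) → (β → M) → Prop}
    (hP : DefSet L M {w : α ⊕ β → M | P (w ∘ Sum.inl) (w ∘ Sum.inr)}) :
    DefSet L M {v | ∀ b, P v b} :=
  Definable.forall_of_finite hP

theorem DefSet.all_elem {P : (α → M) → M → Prop}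
    (hP : DefSet L M {w : α ⊕ Fin 1 → M | P (w ∘ Sum.inl) (w (Sum.inr 0))}) :
    DefSet L M {v | ∀ y, P v y} := by
  have h := DefSet.all (P := fun v (b : Fin 1 → M) => P v (b 0)) hP
  convert h using 2
  ext v
  exact ⟨fun h b => h (b 0), fun h y => h fun _ => y⟩

theorem DefSet.forall_finite {ι : Type} [Finite ι] {P : ι → (α → M) → Prop}
    (hP : ∀ i, DefSet L M {v | P i v}) : DefSet L M {v | ∀ i, P i v} := by
  rw [ofPred_forall]
  exact definable_iInter_of_finite hP

theorem DefSet.subst [Finite β] {A : Set (β → M)} (hA : DefSet L M A)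
    (F : (α → M) → β → M)
    (hF : ∀ i, (univ : Set M).DefinableFun L fun v => F v i) :
    DefSet L M {v | F v ∈ A} :=
  Definable.preimage_map hF hA

theorem definableFun_coord (i : α) : (univ : Set M).DefinableFun L fun v : α → M => v i :=
  DefinableFun.proj L

theorem definableFun_param (a : M) : (univ : Set M).DefinableFun L fun _ : α → M => a :=
  L.definableFun_const α (mem_univ a)

theorem DefSet.eq {f g : (α → M) → M} (hf : (univ : Set M).DefinableFun L f)
    (hg : (univ : Set M).DefinableFun L g) : DefSet L M {v | f v = g v} :=
  DefinableFun.ofPred_eq hf hg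

/-- A fibre of a definable set over a tuple of parameters is definable. -/
theorem DefSet.fix [Finite α] [Finite β] {A : Set (α ⊕ β → M)} (hA : DefSet L M A) (b : β → M) :
    DefSet L M {v : α → M | Sum.elim v b ∈ A} :=
  hA.subst _ (by
    rintro (i | i)
    · exact definableFun_coord i
    · exact definableFun_param (b i))

end Definability

section Saturation

theorem exists_mem_of_antitone_fin_one (hM : IsLPlusSaturated L M) (D : ℕ → Set (Fin 1 → M))
    (hD : ∀ m, DefSet L M (D m)) (hanti : Antitone D) (hne : ∀ m, (D m).Nonempty) :
    ∃ a : M, ∀ m, (fun _ => a) ∈ D m := by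
  choose A _ hA using fun m => definable_iff_finitely_definable.1 (hD m)
  let C : Set M := ⋃ m, (A m : Set M)
  have hC : #C ≤ L.card + ℵ₀ :=
    (mk_le_aleph0_iff.2 (countable_iUnion fun m => (A m).countable_toSet).to_subtype).trans
      (self_le_add_left _ _)
  choose φ hφ using fun m => (hA m).mono (subset_iUnion (fun m => (A m : Set M)) m)
  have hmem (m : ℕ) (v : Fin 1 → M) : v ∈ D m ↔ (φ m).Realize v := by
    conv_lhs => rw [hφ m]
    rfl
  obtain ⟨a, ha⟩ := hM C hC (range φ) (by
    intro s hs
    have hs' : ∀ ψ ∈ s, ∃ m, φ m = ψ := fun ψ hψ => hs hψ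
    choose! idx hidx using hs'
    obtain ⟨v, hv⟩ := hne (s.sup idx)
    refine ⟨v 0, fun ψ hψ => ?_⟩
    have hle : idx ψ ≤ s.sup idx := Finset.le_sup hψ
    have hv' := (hmem _ _).1 (hanti hle hv)
    rw [hidx ψ hψ] at hv'
    convert hv' using 1
    ext i
    rw [Subsingleton.elim i 0])
  exact ⟨a, fun m => (hmem m _).2 (ha _ ⟨m, rfl⟩)⟩

/-- Countable saturation in finitely many variables. -/
theorem exists_mem_of_antitone (hM : IsLPlusSaturated L M) {n : ℕ} (D : ℕ → Set (Fin n → M))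
    (hD : ∀ m, DefSet L M (D m)) (hanti : Antitone D) (hne : ∀ m, (D m).Nonempty) :
    ∃ v, ∀ m, v ∈ D m := by
  induction n with
  | zero =>
    obtain ⟨v, -⟩ := hne 0
    refine ⟨v, fun m => ?_⟩
    obtain ⟨w, hw⟩ := hne m
    rwa [Subsingleton.elim v w]
  | succ n ih =>
    obtain ⟨a, ha⟩ := exists_mem_of_antitone_fin_one hM
      (fun m => {x : Fin 1 → M | ∃ t : Fin n → M, (Fin.cons (x 0) t : Fin (n + 1) → M) ∈ D m})
      (fun m => DefSet.ex ((hD m).subst _ (by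
        refine Fin.cases ?_ fun i => ?_
        · exact definableFun_coord (Sum.inl 0)
        · exact definableFun_coord (Sum.inr i))))
      (fun m m' h x ⟨t, ht⟩ => ⟨t, hanti h ht⟩)
      (fun m => by
        obtain ⟨v, hv⟩ := hne m
        exact ⟨fun _ => v 0, Fin.tail v, by rwa [Fin.cons_self_tail]⟩)
    obtain ⟨t, ht⟩ := ih (fun m => {t | (Fin.cons a t : Fin (n + 1) → M) ∈ D m})
      (fun m => (hD m).subst _ (by
        refine Fin.cases ?_ fun i => ?_
        · exact definableFun_param a
        · exact definableFun_coord i))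
      (fun m m' h t ht => hanti h ht) ha
    exact ⟨_, ht⟩

/-- The members of a definable family of finite subsets of `M` have bounded size. -/
theorem exists_ncard_le (hM : IsLPlusSaturated L M) {n : ℕ} (F : (Fin n → M) → Set M)
    (hF : DefSet L M {w : Fin n ⊕ Fin 1 → M | w (Sum.inr 0) ∈ F (w ∘ Sum.inl)})
    (hfin : ∀ t, (F t).Finite) : ∃ N, ∀ t, (F t).ncard ≤ N := by
  by_contra! hcon
  obtain ⟨t, ht⟩ := exists_mem_of_antitone hM
    (fun m => {t | ∃ z : Fin m → M,
      (∀ q : {q : Fin m × Fin m // q.1 ≠ q.2}, z q.1.1 ≠ z q.1.2) ∧ ∀ i, z i ∈ F t})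
    (fun m => DefSet.ex <| DefSet.and
      (DefSet.forall_finite fun q =>
        (DefSet.eq (definableFun_coord (Sum.inr q.1.1)) (definableFun_coord (Sum.inr q.1.2))).not)
      (DefSet.forall_finite fun i => hF.subst
        (fun w : Fin n ⊕ Fin m → M => Sum.elim (w ∘ Sum.inl) fun _ => w (Sum.inr i)) (by
          rintro (j | j)
          · exact definableFun_coord (Sum.inl j)
          · exact definableFun_coord (Sum.inr i))))
    (fun m m' h t ⟨z, hz, hzF⟩ => ⟨z ∘ Fin.castLE h,
      fun q => hz ⟨(q.1.1.castLE h, q.1.2.castLE h), fun h' => q.2 (Fin.castLE_injective h h')⟩,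
      fun i => hzF _⟩)
    (fun m => by
      obtain ⟨t, ht⟩ := hcon m
      obtain ⟨s, hs, rfl⟩ := Set.exists_subset_card_eq ht.le
      have := ((hfin t).subset hs).to_subtype
      refine ⟨t, fun i => ((Finite.equivFin s).symm i : M), fun q h => q.2 ?_,
        fun i => hs (Subtype.coe_prop _)⟩
      exact (Finite.equivFin s).symm.injective (Subtype.ext h))
  obtain ⟨z, hz, hzF⟩ := ht ((F t).ncard + 1)
  have hinj : Function.Injective z := fun i j h => by_contra fun hij => hz ⟨(i, j), hij⟩ h
  have := ncard_le_ncard (range_subset_iff.2 hzF) (hfin t)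
  rw [← image_univ, ncard_image_of_injective _ hinj, ncard_univ] at this
  simp at this

end Saturation

namespace DefUniformBasis

variable (U : DefUniformBasis L M)

theorem refl_mem {c : Fin U.n → M} (hc : c ∈ U.dom) (x : M) : (x, x) ∈ U.ent c :=
  (U.inter_eq_diag x x).2 rfl c hc

theorem symm_mem {c : Fin U.n → M} (hc : c ∈ U.dom) {x y : M} (h : (x, y) ∈ U.ent c) :
    (y, x) ∈ U.ent c :=
  U.symm c hc x y h

theorem exists_ent_subset_inter {c d : Fin U.n → M} (hc : c ∈ U.dom) (hd : d ∈ U.dom) :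
    ∃ e ∈ U.dom, U.ent e ⊆ U.ent c ∧ U.ent e ⊆ U.ent d := by
  obtain ⟨e, he, h⟩ := U.directed c hc d hd
  exact ⟨e, he, fun p hp => (h p.1 p.2 hp).1, fun p hp => (h p.1 p.2 hp).2⟩

theorem exists_ent_comp {c : Fin U.n → M} (hc : c ∈ U.dom) :
    ∃ d ∈ U.dom, ∀ x y z, (x, y) ∈ U.ent d → (y, z) ∈ U.ent d → (x, z) ∈ U.ent c :=
  U.comp c hc

theorem exists_ent_subset_of_finset {ι : Type*} (s : Finset ι) (c : ι → Fin U.n → M)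
    (hc : ∀ i ∈ s, c i ∈ U.dom) : ∃ e ∈ U.dom, ∀ i ∈ s, U.ent e ⊆ U.ent (c i) := by
  classical
  induction s using Finset.induction_on with
  | empty => exact ⟨_, U.dom_nonempty.some_mem, by simp⟩
  | insert a s _ ih =>
    obtain ⟨e, he, hes⟩ := ih fun i hi => hc i (Finset.mem_insert_of_mem hi)
    obtain ⟨e', he', h₁, h₂⟩ :=
      U.exists_ent_subset_inter (hc a (Finset.mem_insert_self a s)) he
    refine ⟨e', he', fun i hi => ?_⟩
    rcases Finset.mem_insert.1 hi with rfl | hi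
    · exact h₁
    · exact h₂.trans (hes i hi)

theorem self_mem_ballk {k : ℕ} {c : Fin U.n → M} (hc : c ∈ U.dom) (p : Fin k → M) :
    p ∈ U.ballk c p :=
  fun i => U.refl_mem hc (p i)

theorem isOpenk_interiork {k : ℕ} (A : Set (Fin k → M)) : U.IsOpenk (U.interiork A) := by
  rintro x ⟨c, hc, hcA⟩
  obtain ⟨d, hd, hdc⟩ := U.exists_ent_comp hc
  exact ⟨d, hd, fun y hy => ⟨d, hd, fun z hz => hcA fun i => hdc _ _ _ (hy i) (hz i)⟩⟩

theorem interiork_subset {k : ℕ} (A : Set (Fin k → M)) : U.interiork A ⊆ A :=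
  fun x ⟨_, hc, hcA⟩ => hcA (U.self_mem_ballk hc x)

theorem definable_ent {α : Type} {f g : (α → M) → M} {h : (α → M) → Fin U.n → M}
    (hf : (univ : Set M).DefinableFun L f) (hg : (univ : Set M).DefinableFun L g)
    (hh : ∀ i, (univ : Set M).DefinableFun L fun v => h v i) :
    DefSet L M {v | (f v, g v) ∈ U.ent (h v)} :=
  U.phi_def.subst (fun v => Sum.elim ![f v, g v] (h v)) (by
    rintro (i | i)
    · fin_cases i
      · exact hf
      · exact hg
    · exact hh i)

/-- The dimension of a subset of `M^k` with empty interior is less than `k`. -/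
theorem topDim_lt {k : ℕ} {A : Set (Fin k → M)} (hA : U.interiork A = ∅) :
    U.topDim A < (k : WithBot ℕ) := by
  unfold topDim
  split_ifs with hne
  · exact WithBot.bot_lt_coe k
  have hlt : ∀ l ∈ {l : ℕ | ∃ σ : Fin l → Fin k, Function.Injective σ ∧
      (U.interiork ((fun v => v ∘ σ) '' A)).Nonempty}, l < k := by
    rintro l ⟨σ, hσ, x, c, hc, hx⟩
    have hle : l ≤ k := by simpa using Fintype.card_le_of_injective σ hσ
    refine lt_of_le_of_ne hle ?_
    rintro rfl
    have hbij : Function.Bijective σ := Finite.injective_iff_bijective.1 hσ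
    let τ := Equiv.ofBijective σ hbij
    have hmem : x ∘ τ.symm ∈ U.interiork A := by
      refine ⟨c, hc, fun y hy => ?_⟩
      obtain ⟨a, ha, hay⟩ := hx (show y ∘ σ ∈ U.ballk c x from fun i => by
        simpa [τ] using hy (τ i))
      rwa [← hbij.surjective.injective_comp_right hay]
    simp [hA] at hmem
  have hzero : (0 : ℕ) ∈ {l : ℕ | ∃ σ : Fin l → Fin k, Function.Injective σ ∧
      (U.interiork ((fun v => v ∘ σ) '' A)).Nonempty} := by
    obtain ⟨a, ha⟩ := nonempty_iff_ne_empty.2 hne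
    obtain ⟨c, hc⟩ := U.dom_nonempty
    exact ⟨Fin.elim0, fun i => i.elim0, Fin.elim0, c, hc,
      fun y _ => ⟨a, ha, Subsingleton.elim _ _⟩⟩
  exact WithBot.coe_lt_coe.2 (hlt _ (Nat.sSup_mem ⟨0, hzero⟩ ⟨k, fun l hl => (hlt l hl).le⟩))

/-- A family indexed by entourages that grows as the entourages shrink. -/
def Growing {X : Type*} (W : (Fin U.n → M) → Set X) : Prop :=
  ∀ c ∈ U.dom, ∀ e ∈ U.dom, U.ent e ⊆ U.ent c → W c ⊆ W e

end DefUniformBasis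

namespace Setting

variable (S : Setting L M)

theorem ball_infinite {c : Fin S.n → M} (hc : c ∈ S.dom) (x : M) :
    (S.ball c x).Infinite := by
  classical
  intro hfin
  have hsep : ∀ y ∈ hfin.toFinset.erase x, ∃ d ∈ S.dom, (x, y) ∉ S.ent d := by
    intro y hy
    by_contra! h
    exact Finset.ne_of_mem_erase hy ((S.inter_eq_diag x y).1 h).symm
  choose! d hd hxd using hsep
  obtain ⟨e, he, hed⟩ := S.exists_ent_subset_of_finset _ d hd
  obtain ⟨e', he', h₁, h₂⟩ := S.exists_ent_subset_inter hc he
  obtain ⟨y, hyx, hy⟩ := S.noIsolated x e' he'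
  have hys : y ∈ hfin.toFinset.erase x :=
    Finset.mem_erase.2 ⟨hyx, hfin.mem_toFinset.2 (h₁ hy)⟩
  exact hxd y hys (hed y hys (h₂ hy))

/-- An infinite definable set covered by finitely many growing definable families contains a
ball that is contained in a single member of one of the families. -/
theorem exists_ball_subset {ι : Type} [Finite ι] (W : ι → (Fin S.n → M) → Set M)
    (hW : ∀ i, DefSet L M {w : Fin S.n ⊕ Fin 1 → M | w (Sum.inr 0) ∈ W i (w ∘ Sum.inl)})
    (hmono : ∀ i, S.Growing (W i)) {B : Set M} (hB : DefSet1 L M B) (hinf : B.Infinite)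
    (hcov : ∀ y ∈ B, ∃ i, ∃ c ∈ S.dom, y ∈ W i c) :
    ∃ i, ∃ c ∈ S.dom, ∃ y ∈ B, S.ball c y ⊆ W i c := by
  let F (i : ι) (c : Fin S.n → M) : Set M := {y | c ∈ S.dom ∧ y ∈ B ∧ y ∈ W i c}
  have hF (i : ι) :
      DefSet L M {w : Fin S.n ⊕ Fin 1 → M | w (Sum.inr 0) ∈ F i (w ∘ Sum.inl)} := by
    refine DefSet.and ?_ (DefSet.and ?_ (hW i))
    · exact S.dom_def.subst _ fun j => definableFun_coord (Sum.inl j)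
    · exact hB.subst (fun w => w ∘ Sum.inr) fun j => definableFun_coord (Sum.inr j)
  by_cases hfin : ∀ i c, (F i c).Finite
  · exfalso
    choose N hN using fun i => exists_ncard_le S.saturated (F i) (hF i) (hfin i)
    have hunion (i : ι) : (⋃ c, F i c).Finite := by
      by_contra hinf'
      obtain ⟨s, hs, hcard⟩ := Set.Infinite.exists_subset_card_eq hinf' (N i + 1)
      have hs' : ∀ y ∈ s, ∃ c, y ∈ F i c := fun y hy => mem_iUnion.1 (hs hy)
      choose! c hc using hs'
      obtain ⟨e, he, hes⟩ := S.exists_ent_subset_of_finset s c fun y hy => (hc y hy).1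
      have hsub : (s : Set M) ⊆ F i e := fun y hy =>
        ⟨he, (hc y hy).2.1, hmono i _ (hc y hy).1 e he (hes y hy) (hc y hy).2.2⟩
      have := (ncard_le_ncard hsub (hfin i e)).trans (hN i e)
      rw [ncard_coe_finset] at this
      omega
    refine hinf ((finite_iUnion hunion).subset fun y hy => ?_)
    obtain ⟨i, c, hc, hyc⟩ := hcov y hy
    exact mem_iUnion.2 ⟨i, mem_iUnion.2 ⟨c, hc, hy, hyc⟩⟩
  · push Not at hfin
    obtain ⟨i, c, hic⟩ := hfin
    obtain ⟨y, d, hd, hdy⟩ := S.infInterior (F i c)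
      ((hF i).subst (fun v => Sum.elim c v) (by
        rintro (j | j)
        · exact definableFun_param (c j)
        · exact definableFun_coord j)) hic
    have hy := hdy (S.refl_mem hd y)
    obtain ⟨e, he, hec, hed⟩ := S.exists_ent_subset_inter hy.1 hd
    exact ⟨i, e, he, y, hy.2.1, fun z hz => hmono i c hy.1 e he hec (hdy (hed hz)).2.2⟩

/-- If an open set is covered by finitely many growing definable families, then some member of
one of the families has nonempty interior. -/
theorem exists_ballk_subset {k : ℕ} {ι : Type} [Finite ι]
    (W : ι → (Fin S.n → M) → Set (Fin k → M))
    (hW : ∀ i, DefSet L M {w : Fin k ⊕ Fin S.n → M | w ∘ Sum.inl ∈ W i (w ∘ Sum.inr)})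
    (hmono : ∀ i, S.Growing (W i)) {p : Fin k → M} {e : Fin S.n → M} (he : e ∈ S.dom)
    (hcov : ∀ q ∈ S.ballk e p, ∃ i, ∃ c ∈ S.dom, q ∈ W i c) :
    ∃ i, ∃ c ∈ S.dom, ∃ q, S.ballk c q ⊆ W i c := by
  induction k generalizing ι with
  | zero =>
    obtain ⟨i, c, hc, hi⟩ := hcov p (S.self_mem_ballk he p)
    exact ⟨i, c, hc, p, fun q _ => by rwa [Subsingleton.elim q p]⟩
  | succ k ih =>
    let V (i : ι) (y : M) (c : Fin S.n → M) : Set (Fin k → M) :=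
      {t | ∀ y', (y, y') ∈ S.ent c → (Fin.cons y' t : Fin (k + 1) → M) ∈ W i c}
    have hV (i : ι) : DefSet L M {w : (Fin k ⊕ Fin S.n) ⊕ Fin 1 → M |
        w ∘ Sum.inl ∘ Sum.inl ∈ V i (w (Sum.inr 0)) (w ∘ Sum.inl ∘ Sum.inr)} := by
      refine DefSet.all_elem (DefSet.imp ?_ ?_)
      · exact S.definable_ent (definableFun_coord (Sum.inl (Sum.inr 0)))
          (definableFun_coord (Sum.inr 0))
          fun j => definableFun_coord (Sum.inl (Sum.inl (Sum.inr j)))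
      · refine (hW i).subst (fun w : ((Fin k ⊕ Fin S.n) ⊕ Fin 1) ⊕ Fin 1 → M =>
          Sum.elim (Fin.cons (w (Sum.inr 0)) fun j => w (Sum.inl (Sum.inl (Sum.inl j))))
            fun j => w (Sum.inl (Sum.inl (Sum.inr j)))) ?_
        rintro (j | j)
        · refine Fin.cases ?_ (fun j => ?_) j
          · exact definableFun_coord (Sum.inr 0)
          · exact definableFun_coord (Sum.inl (Sum.inl (Sum.inl j)))
        · exact definableFun_coord (Sum.inl (Sum.inl (Sum.inr j)))
    have hVmono (i : ι) (y : M) : S.Growing (V i y) := fun c hc d hd hdc t ht y' hy' =>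
      hmono i c hc d hd hdc (ht y' (hdc hy'))
    let Bad (t : Fin k → M) : Set M :=
      {y | t ∈ S.ballk e (Fin.tail p) ∧ (p 0, y) ∈ S.ent e ∧
        ∀ i, ¬ ∃ c, c ∈ S.dom ∧ t ∈ V i y c}
    have hBad : DefSet L M {w : Fin k ⊕ Fin 1 → M | w (Sum.inr 0) ∈ Bad (w ∘ Sum.inl)} := by
      refine DefSet.and ?_ (DefSet.and ?_ (DefSet.forall_finite fun i =>
        DefSet.not (DefSet.ex (DefSet.and ?_ ?_))))
      · exact DefSet.forall_finite fun j => S.definable_ent (definableFun_param _)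
          (definableFun_coord (Sum.inl j)) fun _ => definableFun_param _
      · exact S.definable_ent (definableFun_param _)
          (definableFun_coord (Sum.inr 0)) fun _ => definableFun_param _
      · exact S.dom_def.subst _ fun j => definableFun_coord (Sum.inr j)
      · refine (hV i).subst (fun w : (Fin k ⊕ Fin 1) ⊕ Fin S.n → M =>
          Sum.elim (Sum.elim (fun j => w (Sum.inl (Sum.inl j))) fun j => w (Sum.inr j))
            fun _ => w (Sum.inl (Sum.inr 0))) ?_
        rintro ((j | j) | j)
        · exact definableFun_coord (Sum.inl (Sum.inl j))
        · exact definableFun_coord (Sum.inr j)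
        · exact definableFun_coord (Sum.inl (Sum.inr 0))
    have hBadfin (t : Fin k → M) : (Bad t).Finite := by
      by_contra hinf
      obtain ⟨i, c, hc, y, hy, hsub⟩ := S.exists_ball_subset
        (fun i c => {y | (Fin.cons y t : Fin (k + 1) → M) ∈ W i c})
        (fun i => (hW i).subst (fun w : Fin S.n ⊕ Fin 1 → M =>
          Sum.elim (Fin.cons (w (Sum.inr 0)) t) (w ∘ Sum.inl)) (by
            rintro (j | j)
            · refine Fin.cases ?_ (fun j => ?_) j
              · exact definableFun_coord (Sum.inr 0)
              · exact definableFun_param (t j)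
            · exact definableFun_coord (Sum.inl j)))
        (fun i c hc d hd hdc y hy => hmono i c hc d hd hdc hy) (B := Bad t)
        (hBad.subst (fun v => Sum.elim t v) (by
          rintro (j | j)
          · exact definableFun_param (t j)
          · exact definableFun_coord j)) hinf
        (fun y hy => hcov _ (Fin.cases hy.2.1 fun j => hy.1 j))
      exact hy.2.2 i ⟨c, hc, hsub⟩
    obtain ⟨N, hN⟩ := exists_ncard_le S.saturated Bad hBad hBadfin
    obtain ⟨s, hs, hcard⟩ := (S.ball_infinite he (p 0)).exists_subset_card_eq (N + 1)
    obtain ⟨⟨i, y⟩, c, hc, t, ht⟩ := ih (ι := ι × Fin (N + 1))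
      (fun ij c => V ij.1 (s.equivFinOfCardEq hcard |>.symm ij.2) c)
      (fun ij => (hV ij.1).fix fun _ => (s.equivFinOfCardEq hcard |>.symm ij.2 : M))
      (fun ij => hVmono _ _) (p := Fin.tail p)
      (fun t ht => by
        by_contra! hcon
        have hsub : (s : Set M) ⊆ Bad t := fun y hy => ⟨ht, hs hy, fun i ⟨c, hc, hyc⟩ =>
          hcon (i, s.equivFinOfCardEq hcard ⟨y, hy⟩) c hc (by simpa using hyc)⟩
        have := (ncard_le_ncard hsub (hBadfin t)).trans (hN t)
        rw [ncard_coe_finset] at this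
        omega)
    refine ⟨i, c, hc, Fin.cons (s.equivFinOfCardEq hcard |>.symm y : M) t, fun q hq => ?_⟩
    have := ht (fun j => by simpa [Fin.tail] using hq j.succ : Fin.tail q ∈ S.ballk c t) (q 0)
      (by simpa using hq 0)
    rwa [Fin.cons_self_tail] at this

end Setting

theorem definable_map_eq {α : Type} [Finite α] {k l : ℕ} {f : (Fin k → M) → (Fin l → M)}
    (hf : DefRel L M {p : (Fin k → M) × (Fin l → M) | p.2 = f p.1}) (g h : Fin k → α) :
    DefSet L M {v : α → M | f (v ∘ g) = f (v ∘ h)} := by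
  have hgraph (g : Fin k → α) :
      DefSet L M {w : α ⊕ Fin l → M | w ∘ Sum.inr = f ((w ∘ Sum.inl) ∘ g)} :=
    DefSet.subst hf
      (fun w : α ⊕ Fin l → M => Sum.elim (fun i => w (Sum.inl (g i))) (w ∘ Sum.inr)) (by
        rintro (i | i) <;> exact definableFun_coord _)
  convert DefSet.ex (P := fun (v : α → M) (q : Fin l → M) => q = f (v ∘ g) ∧ q = f (v ∘ h))
    (DefSet.and (hgraph g) (hgraph h)) using 2
  ext v
  simp

/-- If `f : M^k → M^l` is a definable function with finite fibers, then almost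
every `p ∈ M^k` has a neighborhood on which `f` is injective. -/
theorem statement7 (S : Setting L M) {k l : ℕ} (f : (Fin k → M) → (Fin l → M))
    (hfdef : DefRel L M {p : (Fin k → M) × (Fin l → M) | p.2 = f p.1})
    (hfib : ∀ q : Fin l → M, {p | f p = q}.Finite) :
    ∃ B : Set (Fin k → M), DefSet L M B ∧
      S.toDefUniformBasis.topDim ((Set.univ : Set (Fin k → M)) \ B) < (k : WithBot ℕ) ∧
      ∀ p ∈ B, ∃ O : Set (Fin k → M), S.toDefUniformBasis.IsOpenk O ∧ p ∈ O ∧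
        Set.InjOn f O := by
  have hfib_isolated (p : Fin k → M) :
      ∃ c ∈ S.dom, ∀ q, (∀ j, (p j, q j) ∈ S.ent c) → f q = f p → q = p := by
    classical
    have hsep : ∀ q ∈ (hfib (f p)).toFinset.erase p, ∃ d ∈ S.dom, ∃ j, (p j, q j) ∉ S.ent d := by
      intro q hq
      by_contra! h
      exact Finset.ne_of_mem_erase hq
        (funext fun j => (S.inter_eq_diag _ _).1 fun d hd => h d hd j).symm
    have := S.nonempty
    choose! d hd hd' using hsep
    obtain ⟨e, he, hed⟩ := S.exists_ent_subset_of_finset _ d hd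
    refine ⟨e, he, fun q hq hqp => by_contra fun hne => ?_⟩
    have hmem : q ∈ (hfib (f p)).toFinset.erase p :=
      Finset.mem_erase.2 ⟨hne, (hfib (f p)).mem_toFinset.2 hqp⟩
    obtain ⟨j, hj⟩ := hd' q hmem
    exact hj (hed q hmem (hq j))
  let B : Set (Fin k → M) := {p | ∃ c, c ∈ S.dom ∧ ∀ x, x ∈ S.ballk c p → ∀ y,
    y ∈ S.ballk c p → f x = f y → ∀ j, x j = y j}
  refine ⟨B, ?_, S.topDim_lt (eq_empty_of_forall_notMem ?_), ?_⟩
  · refine DefSet.ex (DefSet.and ?_ (DefSet.all (DefSet.imp ?_ (DefSet.all (DefSet.imp ?_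
      (DefSet.imp ?_ ?_))))))
    · exact S.dom_def.subst _ fun j => definableFun_coord (Sum.inr j)
    · exact DefSet.forall_finite fun j => S.definable_ent
        (definableFun_coord (Sum.inl (Sum.inl j))) (definableFun_coord (Sum.inr j))
        fun i => definableFun_coord (Sum.inl (Sum.inr i))
    · exact DefSet.forall_finite fun j => S.definable_ent
        (definableFun_coord (Sum.inl (Sum.inl (Sum.inl j)))) (definableFun_coord (Sum.inr j))
        fun i => definableFun_coord (Sum.inl (Sum.inl (Sum.inr i)))
    · exact definable_map_eq hfdef (fun j => Sum.inl (Sum.inr j)) Sum.inr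
    · exact DefSet.forall_finite fun j => DefSet.eq
        (definableFun_coord (Sum.inl (Sum.inr j))) (definableFun_coord (Sum.inr j))
  · rintro p ⟨e, he, hsub⟩
    obtain ⟨-, c, hc, q, hq⟩ := S.exists_ballk_subset (ι := Unit)
      (fun _ c => {x | x ∈ S.ballk e p ∧ ∀ y, y ∈ S.ballk c x → f y = f x → ∀ j, y j = x j})
      (fun _ => by
        refine DefSet.and ?_ (DefSet.all (DefSet.imp ?_ (DefSet.imp ?_ ?_)))
        · exact DefSet.forall_finite fun j => S.definable_ent (definableFun_param _)
            (definableFun_coord (Sum.inl j)) fun _ => definableFun_param _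
        · exact DefSet.forall_finite fun j => S.definable_ent
            (definableFun_coord (Sum.inl (Sum.inl j))) (definableFun_coord (Sum.inr j))
            fun i => definableFun_coord (Sum.inl (Sum.inr i))
        · exact definable_map_eq hfdef Sum.inr (fun j => Sum.inl (Sum.inl j))
        · exact DefSet.forall_finite fun j => DefSet.eq
            (definableFun_coord (Sum.inr j)) (definableFun_coord (Sum.inl (Sum.inl j))))
      (fun _ c _ d _ hdc x hx => ⟨hx.1, fun y hy => hx.2 y fun j => hdc (hy j)⟩) he
      (fun x hx => by
        obtain ⟨c, hc, h⟩ := hfib_isolated x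
        exact ⟨(), c, hc, hx, fun y hy hyx j => congrFun (h y hy hyx) j⟩)
    refine (hsub (hq (S.self_mem_ballk hc q)).1).2 ?_
    obtain ⟨d, hd, hdc⟩ := S.exists_ent_comp hc
    obtain ⟨d', hd', h₁, h₂⟩ := S.exists_ent_subset_inter hc hd
    exact ⟨d', hd', fun x hx y hy => (hq fun j => h₁ (hy j)).2 x fun j =>
      hdc _ _ _ (S.symm_mem hd (h₂ (hy j))) (h₂ (hx j))⟩
  · rintro p ⟨c, hc, h⟩
    refine ⟨S.interiork (S.ballk c p), S.isOpenk_interiork _, ⟨c, hc, Subset.rfl⟩, ?_⟩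
    intro x hx y hy hxy
    exact funext (h x (S.interiork_subset _ hx) y (S.interiork_subset _ hy) hxy)

end DpTame
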